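/- Define q₁, r₁, u₁ : ℝ² → ℝ by q₁(x,t) = 1 / (2·cosh(x+t)), r₁(x,t) = 1 / cosh(x+t), and u₁(x,t) = 3 / (1 + cosh(2x+2t)). Then (u₁, q₁, r₁) satisfies the system (def1Vqru): u₁ₜ = 3 q₁ r₁ₓ + 3 q₁ₓ r₁; q₁ₜ = q₁ₓₓₓ + 2 u₁ q₁ₓ + q₁ u₁ₓ; r₁ₜ = r₁ₓₓₓ + 2 u₁ r₁ₓ + r₁ u₁ₓ. -/

import Mathlib

/-- Partial derivative in the first (spatial) variable of a function `ℝ² → ℝ`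
written in curried form. -/
noncomputable def pdx (f : ℝ → ℝ → ℝ) : ℝ → ℝ → ℝ := fun x t => deriv (fun y => f y t) x

/-- Partial derivative in the second (time) variable. -/
noncomputable def pdt (f : ℝ → ℝ → ℝ) : ℝ → ℝ → ℝ := fun x t => deriv (fun s => f x s) t

/-- The spatial derivative of a travelling wave `g (x + t)` is the wave with profile `g'`. -/
theorem pdx_eq_of_travelling {f : ℝ → ℝ → ℝ} {g g' : ℝ → ℝ} (hf : ∀ x t, f x t = g (x + t))
    (hg : ∀ ξ, HasDerivAt g (g' ξ) ξ) (x t : ℝ) : pdx f x t = g' (x + t) := by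
  simp only [pdx, hf]
  exact ((hg (x + t)).comp_add_const x t).deriv

/-- The time derivative of a travelling wave `g (x + t)` is the wave with profile `g'`. -/
theorem pdt_eq_of_travelling {f : ℝ → ℝ → ℝ} {g g' : ℝ → ℝ} (hf : ∀ x t, f x t = g (x + t))
    (hg : ∀ ξ, HasDerivAt g (g' ξ) ξ) (x t : ℝ) : pdt f x t = g' (x + t) := by
  simp only [pdt, hf]
  exact ((hg (x + t)).comp_const_add x t).deriv

theorem hasDerivAt_const_div_cosh_pow (a : ℝ) (n : ℕ) (ξ : ℝ) :
    HasDerivAt (fun y => a / Real.cosh y ^ n)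
      (-(n * a) * Real.sinh ξ / Real.cosh ξ ^ (n + 1)) ξ := by
  have hC := (Real.cosh_pos ξ).ne'
  refine ((hasDerivAt_const ξ a).div ((Real.hasDerivAt_cosh ξ).pow n)
    (pow_ne_zero n hC)).congr_deriv ?_
  cases n with
  | zero => simp
  | succ k =>
    simp only [Nat.add_sub_cancel, Pi.pow_apply]
    field_simp
    push_cast
    ring

theorem hasDerivAt_sinh_div_cosh_sq (a ξ : ℝ) :
    HasDerivAt (fun y => -a * Real.sinh y / Real.cosh y ^ 2)
      (a / Real.cosh ξ ^ 1 + -(2 * a) / Real.cosh ξ ^ 3) ξ := by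
  have hC := (Real.cosh_pos ξ).ne'
  refine (((Real.hasDerivAt_sinh ξ).const_mul (-a)).div ((Real.hasDerivAt_cosh ξ).pow 2)
    (pow_ne_zero 2 hC)).congr_deriv ?_
  simp only [Pi.pow_apply]
  field_simp
  norm_num
  linear_combination (-2 * a * Real.cosh ξ) * Real.cosh_sq ξ

/-- Any multiple of `1 / cosh (x + t)` solves the linear equation of the flow with potential
`3 / (2 cosh² (x + t))`. -/
theorem pdt_eq_of_sech {f u : ℝ → ℝ → ℝ} (a : ℝ) (hf : ∀ x t, f x t = a / Real.cosh (x + t) ^ 1)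
    (hu : ∀ x t, u x t = (3 / 2) / Real.cosh (x + t) ^ 2) (x t : ℝ) :
    pdt f x t = pdx (pdx (pdx f)) x t + 2 * u x t * pdx f x t + f x t * pdx u x t := by
  have hf₁ : ∀ x t, pdx f x t = -a * Real.sinh (x + t) / Real.cosh (x + t) ^ 2 := fun x t => by
    simpa using pdx_eq_of_travelling hf (hasDerivAt_const_div_cosh_pow a 1) x t
  have hf₂ := pdx_eq_of_travelling hf₁ (hasDerivAt_sinh_div_cosh_sq a)
  have hf₃ := pdx_eq_of_travelling hf₂ fun ξ =>
    (hasDerivAt_const_div_cosh_pow a 1 ξ).add (hasDerivAt_const_div_cosh_pow (-(2 * a)) 3 ξ)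
  rw [pdt_eq_of_travelling hf (hasDerivAt_const_div_cosh_pow a 1), hf₃, hf₁, hf, hu,
    pdx_eq_of_travelling hu (hasDerivAt_const_div_cosh_pow (3 / 2) 2)]
  have hC := (Real.cosh_pos (x + t)).ne'
  field_simp
  push_cast
  ring

/-- `q₁ = 1/(2 cosh(x+t))`, `r₁ = 1/cosh(x+t)`, `u₁ = 3/(1 + cosh(2x+2t))` solves the
third flow (def1Vqru) of the matrix constrained CKP hierarchy with `m = n = 1`. -/
theorem soliton_solution_def1Vqru
    (q₁ r₁ u₁ : ℝ → ℝ → ℝ)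
    (hq : ∀ x t, q₁ x t = 1 / (2 * Real.cosh (x + t)))
    (hr : ∀ x t, r₁ x t = 1 / Real.cosh (x + t))
    (hu : ∀ x t, u₁ x t = 3 / (1 + Real.cosh (2 * x + 2 * t))) :
    (∀ x t, pdt u₁ x t = 3 * q₁ x t * pdx r₁ x t + 3 * pdx q₁ x t * r₁ x t) ∧
    (∀ x t, pdt q₁ x t = pdx (pdx (pdx q₁)) x t
      + 2 * u₁ x t * pdx q₁ x t + q₁ x t * pdx u₁ x t) ∧
    (∀ x t, pdt r₁ x t = pdx (pdx (pdx r₁)) x t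
      + 2 * u₁ x t * pdx r₁ x t + r₁ x t * pdx u₁ x t) := by
  have hq' : ∀ x t, q₁ x t = (1 / 2) / Real.cosh (x + t) ^ 1 := fun x t => by
    rw [hq, pow_one, div_div]
  have hr' : ∀ x t, r₁ x t = 1 / Real.cosh (x + t) ^ 1 := fun x t => by rw [hr, pow_one]
  have hu' : ∀ x t, u₁ x t = (3 / 2) / Real.cosh (x + t) ^ 2 := fun x t => by
    rw [hu, ← mul_add, Real.cosh_two_mul, Real.sinh_sq, div_div]
    congr 1
    ring
  refine ⟨fun x t => ?_, pdt_eq_of_sech _ hq' hu', pdt_eq_of_sech _ hr' hu'⟩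
  rw [pdt_eq_of_travelling hu' (hasDerivAt_const_div_cosh_pow (3 / 2) 2),
    pdx_eq_of_travelling hr' (hasDerivAt_const_div_cosh_pow 1 1),
    pdx_eq_of_travelling hq' (hasDerivAt_const_div_cosh_pow (1 / 2) 1), hq', hr']
  have hC := (Real.cosh_pos (x + t)).ne'
  field_simp
  push_cast
  ring
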